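/- (Critical points of P_0 escape to infinity) Suppose K has characteristic 0 and there is an integer m ≥ 2 with |m| < 1; let p be the smallest such m (the residue characteristic of K, a prime) and suppose |p| < 1. Let d ≥ 2 be an integer with p ≤ d such that p does not divide d or p² divides d (so in particular d > p), and put P_0 := X^p − p^d·X^d. Then every c ∈ K with c ≠ 0 and P_0'(c) = 0 satisfies d·p^{d−1}·c^{d−p} = 1 in K, hence |c| = |d·p^{d−1}|^{−1/(d−p)} > 1; moreover |P_0(c)| ≥ |c|^p, and |P_0^n(c)| → +∞ as n → +∞. In particular, no cycle of P_0 contained in {z : |z| = 1} attracts a critical point of P_0, so the bound in Theorem A is sharp. -/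

import Mathlib

/-!
STATEMENT 14 (Critical points of `P₀ = X^p − p^d·X^d` escape to infinity): with `K`,
`p`, `d` as in Statement 13, every nonzero critical point `c` of `P₀` satisfies
`d·p^(d−1)·c^(d−p) = 1`, hence `‖c‖ = ‖d·p^(d−1)‖^(−1/(d−p)) > 1`; moreover
`‖P₀(c)‖ ≥ ‖c‖^p`, and `‖P₀^n(c)‖ → +∞`.
-/

open Polynomial Filter

/-- The polynomial `P₀ = X^p − p^d·X^d`. -/
noncomputable def P0 {K : Type*} [Field K] (p d : ℕ) : Polynomial K :=
  Polynomial.X ^ p - Polynomial.C ((p : K) ^ d) * Polynomial.X ^ d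

lemma aux_ultra {K : Type*} [NontriviallyNormedField K] [IsUltrametricDist K] (x y : K)
    (h : ‖x‖ ≠ ‖y‖) : ‖x‖ ≤ ‖x - y‖ := by
  have h2 : ‖x + (-y)‖ = max ‖x‖ ‖-y‖ :=
    IsUltrametricDist.norm_add_eq_max_of_norm_ne_norm (by rwa [norm_neg])
  rw [sub_eq_add_neg, h2]
  exact le_max_left _ _

lemma aux_eval {K : Type*} [NontriviallyNormedField K] (p d : ℕ) (hpd : p ≤ d) (z : K) :
    (P0 p d (K := K)).eval z = z ^ p * (1 - (p : K) ^ d * z ^ (d - p)) := by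
  obtain ⟨k, rfl⟩ := Nat.exists_eq_add_of_le hpd
  simp [P0, pow_add]
  ring

lemma aux_ne {K : Type*} [NontriviallyNormedField K] [IsUltrametricDist K] [CharZero K]
    (p : ℕ) (hp2 : 2 ≤ p) (hpnorm : ‖(p : K)‖ < 1)
    (hpmin : ∀ m : ℕ, 2 ≤ m → ‖(m : K)‖ < 1 → p ≤ m)
    (d : ℕ) (hdiv : ¬ p ∣ d ∨ p ^ 2 ∣ d) : ‖(d : K)‖ ≠ ‖(p : K)‖ := by
  have hp0 : 0 < ‖(p : K)‖ := norm_pos_iff.2 (by exact_mod_cast (by omega : p ≠ 0))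
  rcases hdiv with h | ⟨q, rfl⟩
  · intro he
    have hr0 : d % p ≠ 0 := fun h' => h (Nat.dvd_of_mod_eq_zero h')
    have hrp : d % p < p := Nat.mod_lt _ (by omega)
    have hr : 1 ≤ ‖((d % p : ℕ) : K)‖ := by
      by_contra hlt
      push Not at hlt
      by_cases h1 : d % p = 1
      · rw [h1] at hlt
        simp at hlt
      · have := hpmin (d % p) (by omega) hlt
        omega
    have hd : (d : K) = p * (d / p : ℕ) + (d % p : ℕ) := by
      exact_mod_cast (Nat.div_add_mod d p).symm
    have hq : ‖((d / p : ℕ) : K)‖ ≤ 1 := IsUltrametricDist.norm_natCast_le_one K _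
    have h3 : ‖((d % p : ℕ) : K)‖ ≤ max ‖(d : K)‖ ‖-((p : K) * (d / p : ℕ))‖ := by
      have : ((d % p : ℕ) : K) = d + -((p : K) * (d / p : ℕ)) := by
        rw [hd]; ring_nf
      rw [this]
      exact IsUltrametricDist.norm_add_le_max _ _
    rw [norm_neg, norm_mul] at h3
    have h4 : ‖(p : K)‖ * ‖((d / p : ℕ) : K)‖ < 1 := by nlinarith
    have := max_lt (he ▸ hpnorm) h4
    linarith
  · have hq : ‖(q : K)‖ ≤ 1 := IsUltrametricDist.norm_natCast_le_one K _
    push_cast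
    rw [norm_mul, norm_pow]
    apply ne_of_lt
    have : ‖(p : K)‖ ^ 2 < ‖(p : K)‖ := by nlinarith
    nlinarith [sq_nonneg ‖(p : K)‖]

theorem critical_points_of_P0_escape
    {K : Type*} [NontriviallyNormedField K] [IsAlgClosed K]
    [CompleteSpace K] [IsUltrametricDist K] [CharZero K]
    (p : ℕ) (hp2 : 2 ≤ p) (hpnorm : ‖(p : K)‖ < 1)
    (hpmin : ∀ m : ℕ, 2 ≤ m → ‖(m : K)‖ < 1 → p ≤ m)
    (d : ℕ) (hd : 2 ≤ d) (hpd : p ≤ d) (hdiv : ¬ p ∣ d ∨ p ^ 2 ∣ d)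
    (c : K) (hc0 : c ≠ 0) (hcrit : (P0 p d (K := K)).derivative.eval c = 0) :
    (d : K) * (p : K) ^ (d - 1) * c ^ (d - p) = 1 ∧
    ‖c‖ = ‖(d : K) * (p : K) ^ (d - 1)‖ ^ (-(1 : ℝ) / ((d : ℝ) - (p : ℝ))) ∧
    1 < ‖c‖ ∧
    ‖c‖ ^ p ≤ ‖(P0 p d (K := K)).eval c‖ ∧
    Tendsto (fun n => ‖(fun w => (P0 p d (K := K)).eval w)^[n] c‖) atTop atTop := by
  have hp0K : (p : K) ≠ 0 := by exact_mod_cast (by omega : p ≠ 0)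
  have hd0K : (d : K) ≠ 0 := by exact_mod_cast (by omega : d ≠ 0)
  have hp0 : 0 < ‖(p : K)‖ := norm_pos_iff.2 hp0K
  have hd0 : 0 < ‖(d : K)‖ := norm_pos_iff.2 hd0K
  have hd1 : ‖(d : K)‖ ≤ 1 := IsUltrametricDist.norm_natCast_le_one K _
  have hne := aux_ne (K := K) p hp2 hpnorm hpmin d hdiv
  have hlt : p < d := lt_of_le_of_ne hpd (by rintro rfl; exact hne rfl)
  have hc : 0 < ‖c‖ := norm_pos_iff.2 hc0
  have h1 : (d : K) * (p : K) ^ (d - 1) * c ^ (d - p) = 1 := by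
    have hsub : (p : K) * c ^ (p - 1) * ((d : K) * (p : K) ^ (d - 1) * c ^ (d - p))
        = p * c ^ (p - 1) := by
      have e1 : (p : K) ^ d = p * p ^ (d - 1) := by
        rw [← pow_succ']; congr 1; omega
      have e2 : c ^ (d - 1) = c ^ (p - 1) * c ^ (d - p) := by
        rw [← pow_add]; congr 1; omega
      rw [P0, derivative_sub, derivative_C_mul] at hcrit
      simp [derivative_X_pow] at hcrit
      rw [e2, e1] at hcrit
      linear_combination -hcrit
    exact mul_left_cancel₀ (mul_ne_zero hp0K (pow_ne_zero _ hc0)) (by rw [hsub, mul_one])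
  have hk : d - p ≠ 0 := by omega
  set a := ‖(d : K) * (p : K) ^ (d - 1)‖ with ha
  have ha0 : 0 < a := by rw [ha, norm_mul, norm_pow]; positivity
  have h1n : a * ‖c‖ ^ (d - p) = 1 := by
    rw [ha, ← norm_pow, ← norm_mul, h1, norm_one]
  have ha1 : a < 1 := by
    rw [ha, norm_mul, norm_pow]
    have : ‖(p : K)‖ ^ (d - 1) < 1 := pow_lt_one₀ hp0.le hpnorm (by omega)
    nlinarith [pow_pos hp0 (d - 1)]
  have hc1 : 1 < ‖c‖ := by
    by_contra hle
    push Not at hle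
    have := pow_le_one₀ hc.le hle (n := d - p)
    nlinarith
  have h2 : ‖c‖ = a ^ (-(1 : ℝ) / ((d : ℝ) - (p : ℝ))) := by
    have e : a = (‖c‖ ^ (d - p))⁻¹ := eq_inv_of_mul_eq_one_left h1n
    have hdp : ((d : ℝ) - p) = ((d - p : ℕ) : ℝ) := by rw [Nat.cast_sub hpd]
    rw [e, hdp, neg_div, Real.rpow_neg (by positivity), Real.inv_rpow (by positivity), inv_inv,
      one_div, Real.pow_rpow_inv_natCast hc.le hk]
  have h4 : ‖c‖ ^ p ≤ ‖(P0 p d (K := K)).eval c‖ := by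
    have e : (d : K) * (P0 p d (K := K)).eval c = c ^ p * (d - p) := by
      have e1 : (p : K) ^ d = p * p ^ (d - 1) := by
        rw [← pow_succ']; congr 1; omega
      rw [aux_eval p d hpd, e1]
      linear_combination (-c ^ p * p) * h1
    have e' := congrArg norm e
    rw [norm_mul, norm_mul, norm_pow] at e'
    have := aux_ultra _ _ hne
    have hcp : 0 < ‖c‖ ^ p := by positivity
    refine le_of_mul_le_mul_left ?_ hd0
    rw [e']
    nlinarith
  refine ⟨h1, h2, hc1, h4, ?_⟩
  set f : K → K := fun w => (P0 p d (K := K)).eval w with hf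
  have hstart : 1 < ‖(p : K)‖ ^ d * ‖f c‖ ^ (d - p) := by
    have hw : ‖c‖ ^ 2 ≤ ‖f c‖ := (pow_le_pow_right₀ hc1.le hp2).trans h4
    have hw2 : (‖c‖ ^ (d - p)) ^ 2 ≤ ‖f c‖ ^ (d - p) := by
      rw [← pow_mul, mul_comm, pow_mul]
      exact pow_le_pow_left₀ (by positivity) hw _
    have hA : a ^ 2 < ‖(p : K)‖ ^ d := by
      rw [ha, norm_mul, norm_pow, mul_pow, ← pow_mul]
      have : ‖(p : K)‖ ^ ((d - 1) * 2) < ‖(p : K)‖ ^ d :=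
        pow_lt_pow_right_of_lt_one₀ hp0 hpnorm (by omega)
      have h' : ‖(d : K)‖ ^ 2 ≤ 1 := pow_le_one₀ hd0.le hd1
      nlinarith [pow_pos hp0 ((d - 1) * 2)]
    have hX : 0 < (‖c‖ ^ (d - p)) ^ 2 := by positivity
    calc (1 : ℝ) = a ^ 2 * (‖c‖ ^ (d - p)) ^ 2 := by rw [← mul_pow, h1n, one_pow]
      _ < ‖(p : K)‖ ^ d * (‖c‖ ^ (d - p)) ^ 2 := by gcongr
      _ ≤ _ := by gcongr
  have hstep : ∀ z : K, 1 < ‖(p : K)‖ ^ d * ‖z‖ ^ (d - p) → ‖z‖ ^ p ≤ ‖f z‖ := by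
    intro z hz
    have : ‖(1 : K)‖ ≤ ‖1 - (p : K) ^ d * z ^ (d - p)‖ := by
      apply aux_ultra
      rw [norm_one, norm_mul, norm_pow, norm_pow]
      exact hz.ne
    rw [norm_one] at this
    rw [hf]
    simp only
    rw [aux_eval p d hpd, norm_mul, norm_pow]
    exact le_mul_of_one_le_right (by positivity) this
  have hind : ∀ n : ℕ, 1 < ‖(p : K)‖ ^ d * ‖f^[n + 1] c‖ ^ (d - p) ∧
      ‖c‖ ^ (n + 1) ≤ ‖f^[n + 1] c‖ := by
    intro n
    induction n with
    | zero =>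
      refine ⟨by simpa using hstart, ?_⟩
      simpa using (le_self_pow₀ hc1.le (by omega : p ≠ 0)).trans h4
    | succ n ih =>
      obtain ⟨i1, i2⟩ := ih
      rw [Function.iterate_succ_apply']
      set z := f^[n + 1] c
      have hcz : ‖c‖ ≤ ‖z‖ := (le_self_pow₀ hc1.le (by omega)).trans i2
      have hz1 : 1 ≤ ‖z‖ := hc1.le.trans hcz
      have hz2 : ‖z‖ ^ 2 ≤ ‖f z‖ := (pow_le_pow_right₀ hz1 hp2).trans (hstep z i1)
      have hzf : ‖z‖ ≤ ‖f z‖ := by nlinarith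
      refine ⟨i1.trans_le (by gcongr), ?_⟩
      calc ‖c‖ ^ (n + 1 + 1) = ‖c‖ ^ (n + 1) * ‖c‖ := pow_succ _ _
        _ ≤ ‖z‖ * ‖z‖ := by gcongr
        _ ≤ _ := by rw [← sq]; exact hz2
  rw [← tendsto_add_atTop_iff_nat 1]
  refine tendsto_atTop_mono (fun n => (hind n).2) ?_
  exact (tendsto_add_atTop_iff_nat 1).2 (tendsto_pow_atTop_atTop_of_one_lt hc1)
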